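/- Let a, b, N be integers with 1 ≤ b ≤ a ≤ N. For every integer g with ⌈(a+b)/2⌉ ≤ g ≤ a−1, the Hahn polynomials h_g^{−a,−b,−2−N} and h_{a+b−g−1}^{−a,−b,−2−N} are proportional; precisely, for all real x, h_g^{−a,−b,−2−N}(x) · h_{a+b−g−1}^{−a,−b,−2−N}(0) = h_g^{−a,−b,−2−N}(0) · h_{a+b−g−1}^{−a,−b,−2−N}(x). -/

import Mathlib

noncomputable section

open Finset

/-- Pochhammer symbol `(x)_m = x (x+1) ⋯ (x+m-1)`. -/
def poch (x : ℝ) (m : ℕ) : ℝ := ∏ i ∈ Finset.range m, (x + i)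

/-- Complex Pochhammer symbol. -/
def pochC (x : ℂ) (m : ℕ) : ℂ := ∏ i ∈ Finset.range m, (x + i)

/-- `λ^{a,b}(x) = x (x + a + b + 1)`. -/
def lam (a b : ℕ) (x : ℝ) : ℝ := x * (x + a + b + 1)

/-- Complex version of `λ^{a,b}`. -/
def lamC (a b : ℕ) (x : ℂ) : ℂ := x * (x + a + b + 1)

/-- Hahn polynomial `h_n^{α,β,ν}(x)`. -/
def hahn (α β ν : ℝ) (n : ℕ) (x : ℝ) : ℝ :=
  ∑ j ∈ Finset.range (n + 1),
    poch (-(n : ℝ)) j * poch (α + β + n + 1) j * poch (-ν + j) (n - j) *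
      poch (α + j + 1) (n - j) * poch (-x) j / (Nat.factorial j : ℝ)

/-- Dual Hahn polynomial `R_n^{α,β,ν}(x)` for `n : ℕ`. -/
def dualHahnNat (α β ν : ℝ) (n : ℕ) (x : ℝ) : ℝ :=
  ∑ j ∈ Finset.range (n + 1),
    poch (-(n : ℝ)) j * poch (-ν + j) (n - j) * poch (α + j + 1) (n - j) /
        ((Nat.factorial n : ℝ) * (-1) ^ j * (Nat.factorial j : ℝ)) *
      ∏ i ∈ Finset.range j, (x - i * (α + β + 1 + i))

/-- Dual Hahn polynomial with the convention `R_k ≡ 0` for `k < 0`. -/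
def dualHahn (α β ν : ℝ) (k : ℤ) (x : ℝ) : ℝ :=
  if k < 0 then 0 else dualHahnNat α β ν k.toNat x

/-- Complex dual Hahn polynomial. -/
def dualHahnNatC (α β ν : ℂ) (n : ℕ) (x : ℂ) : ℂ :=
  ∑ j ∈ Finset.range (n + 1),
    pochC (-(n : ℂ)) j * pochC (-ν + j) (n - j) * pochC (α + j + 1) (n - j) /
        ((Nat.factorial n : ℂ) * (-1) ^ j * (Nat.factorial j : ℂ)) *
      ∏ i ∈ Finset.range j, (x - i * (α + β + 1 + i))

/-- Complex dual Hahn polynomial with the convention `R_k ≡ 0` for `k < 0`. -/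
def dualHahnC (α β ν : ℂ) (k : ℤ) (x : ℂ) : ℂ :=
  if k < 0 then 0 else dualHahnNatC α β ν k.toNat x

/-- `⌈(a+b)/2⌉`. -/
def ceilHalf (a b : ℕ) : ℕ := (a + b + 1) / 2

/-- The auxiliary polynomials `W_g^{a,b,N;𝓜}(x)`; the third parameter is allowed to be any
real number (so that triples like `(a, b, -2-N-a-b)` can be used). -/
def W (a b : ℕ) (Nr : ℝ) (M : ℕ → ℝ) (g : ℕ) (x : ℝ) : ℝ :=
  if a ≤ g ∧ g ≤ a + b - 1 then
    (-1 : ℝ) ^ (b + g) * (Nat.factorial (g - b) : ℝ) *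
      ((Nat.factorial (a + b - g - 1) : ℝ) * poch (-x) a *
          hahn (a : ℝ) (-(b : ℝ)) (-2 - Nr - a) (g - a) (x - a) +
        (Nat.factorial (g - a) : ℝ) * poch (Nr + a + b + 1 - g) (2 * g - a - b + 1) / M (g - a) *
          hahn (-(a : ℝ)) (-(b : ℝ)) (-2 - Nr) (a + b - g - 1) x)
  else if ceilHalf a b ≤ g ∧ g + 1 ≤ a then
    deriv (fun s : ℝ =>
      hahn (-(a : ℝ) - s) (-(b : ℝ)) (-2 - Nr) g x -
        hahn (-(a : ℝ) - s) (-(b : ℝ)) (-2 - Nr) g 0 /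
            hahn (-(a : ℝ) - s) (-(b : ℝ)) (-2 - Nr) (a + b - g - 1) 0 *
          hahn (-(a : ℝ) - s) (-(b : ℝ)) (-2 - Nr) (a + b - g - 1) x) 0
  else hahn (-(a : ℝ)) (-(b : ℝ)) (-2 - Nr) g x

/-- The mass `ρ_{b,a,N}(x)` of the dual Hahn measure. -/
def rhoDH (a b N : ℕ) (x : ℕ) : ℝ :=
  (2 * (x : ℝ) + a + b + 1) * poch ((b : ℝ) + 1) x * poch (-(N : ℝ)) x * (Nat.factorial N : ℝ) /
    ((-1 : ℝ) ^ x * poch ((x : ℝ) + a + b + 1) (N + 1) * poch ((a : ℝ) + 1) x *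
      (Nat.factorial x : ℝ))

/-- The mass of the measure `ν_{a,b,N}^{𝓜}` at the point `λ^{a,b}(x)`, for `x = -b, …, N`. -/
def mass (a b N : ℕ) (M : ℕ → ℝ) (x : ℤ) : ℝ :=
  if x < 0 then
    (2 * (x : ℝ) + a + b + 1) * poch ((N : ℝ) + 1 - (x : ℝ)) (x + b).toNat /
        poch ((N : ℝ) + b + 1) (x + a + 1).toNat * M (x + b).toNat
  else
    (poch ((N : ℝ) + 1) b) ^ 2 / poch ((b : ℝ) + 1) (a - b) * rhoDH a b N x.toNat /
      ∏ i ∈ Finset.range b, (((x : ℝ) + a + i + 1) * ((x : ℝ) + b - i))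

/-- The pairing `⟨p, q⟩` with respect to `ν_{a,b,N}^{𝓜}`. -/
def pairing (a b N : ℕ) (M : ℕ → ℝ) (p q : ℝ → ℝ) : ℝ :=
  ∑ x ∈ Finset.Icc (-(b : ℤ)) (N : ℤ),
    mass a b N M x * p (lam a b (x : ℝ)) * q (lam a b (x : ℝ))

/-- The determinant `Φ_n^{a,b,N;𝓜}`. -/
def PhiM (a b N : ℕ) (M : ℕ → ℝ) (n : ℕ) : ℝ :=
  Matrix.det (Matrix.of fun i j : Fin a =>
    W a b (N : ℝ) M (b + (i : ℕ)) (-(n : ℝ) + ((j : ℕ) : ℝ)))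

/-- The polynomial `q_n^{a,b,N;𝓜}(x)` given by the determinantal formula. -/
def qM (a b N : ℕ) (M : ℕ → ℝ) (n : ℕ) (x : ℝ) : ℝ :=
  Matrix.det (Matrix.of fun i j : Fin (a + 1) =>
    if (i : ℕ) = 0 then
      (-1 : ℝ) ^ (j : ℕ) * dualHahn (a : ℝ) (b : ℝ) (N : ℝ) ((n : ℤ) - ((j : ℕ) : ℤ)) x /
        poch ((b : ℝ) + N - n + (j : ℕ) + 1) (a - (j : ℕ))
    else
      W a b (N : ℝ) M (b + (i : ℕ) - 1) (-(n : ℝ) + ((j : ℕ) : ℝ) - 1))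

theorem poch_add (x : ℝ) (m n : ℕ) : poch x (m + n) = poch x m * poch (x + m) n := by
  simp only [poch, Finset.prod_range_add]
  congr 1
  refine Finset.prod_congr rfl fun i _ => ?_
  push_cast
  ring

theorem poch_neg_natCast_eq_zero {m j : ℕ} (h : m < j) : poch (-(m : ℝ)) j = 0 :=
  Finset.prod_eq_zero (Finset.mem_range.2 h) (neg_add_cancel _)

theorem poch_add_natCast_sub (y : ℝ) {j m n : ℕ} (hjm : j ≤ m) (hmn : m ≤ n) :
    poch (y + j) (n - j) = poch (y + j) (m - j) * poch (y + m) (n - m) := by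
  rw [← Nat.sub_add_sub_cancel hmn hjm, add_comm (n - m), poch_add, Nat.cast_sub hjm,
    add_assoc y, add_sub_cancel]

/-- If `α + β + n + m + 1 = 0` with `m ≤ n`, then the Hahn polynomial of index `n` is a constant
multiple of the one of index `m`. -/
theorem hahn_eq_mul_hahn (α β ν : ℝ) {m n : ℕ} (hmn : m ≤ n)
    (h : α + β + n + m + 1 = 0) (x : ℝ) :
    hahn α β ν n x =
      poch (-ν + m) (n - m) * poch (α + m + 1) (n - m) * hahn α β ν m x := by
  have hn : α + β + n + 1 = -(m : ℝ) := by linarith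
  have hm : α + β + m + 1 = -(n : ℝ) := by linarith
  unfold hahn
  rw [hn, hm, Finset.mul_sum]
  symm
  refine (Finset.sum_congr rfl fun j hj => ?_).trans
    (Finset.sum_subset (Finset.range_mono (Nat.succ_le_succ hmn)) fun j _ hj => ?_)
  · have hjm : j ≤ m := Nat.lt_succ_iff.1 (Finset.mem_range.1 hj)
    rw [add_right_comm α m, add_right_comm α j, poch_add_natCast_sub (-ν) hjm hmn,
      poch_add_natCast_sub (α + 1) hjm hmn]
    ring
  · have hjm : m < j := by simpa using hj
    simp [poch_neg_natCast_eq_zero hjm]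

/-- For `⌈(a+b)/2⌉ ≤ g ≤ a-1`, the Hahn polynomials `h_g^{-a,-b,-2-N}` and
`h_{a+b-g-1}^{-a,-b,-2-N}` are proportional. -/
theorem duran_hahn_proportional (a b N : ℕ)
    (hb : 1 ≤ b) (hba : b ≤ a) (haN : a ≤ N) :
    ∀ g : ℕ, ceilHalf a b ≤ g → g + 1 ≤ a → ∀ x : ℝ,
      hahn (-(a : ℝ)) (-(b : ℝ)) (-2 - (N : ℝ)) g x *
          hahn (-(a : ℝ)) (-(b : ℝ)) (-2 - (N : ℝ)) (a + b - g - 1) 0 =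
        hahn (-(a : ℝ)) (-(b : ℝ)) (-2 - (N : ℝ)) g 0 *
          hahn (-(a : ℝ)) (-(b : ℝ)) (-2 - (N : ℝ)) (a + b - g - 1) x := by
  intro g hg hga x
  have hle : a + b - g - 1 ≤ g := by unfold ceilHalf at hg; omega
  have hsum : -(a : ℝ) + -(b : ℝ) + g + (a + b - g - 1 : ℕ) + 1 = 0 := by
    have : (a : ℝ) + b = g + (a + b - g - 1 : ℕ) + 1 := by
      exact_mod_cast (by omega : a + b = g + (a + b - g - 1) + 1)
    linarith
  rw [hahn_eq_mul_hahn _ _ _ hle hsum x, hahn_eq_mul_hahn _ _ _ hle hsum 0]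
  ring
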